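/- Let L be a complete lattice and f, g : L → L inflationary and monotone functions. Then for every x ∈ L, the least fixed point of the composition f ∘ g above x equals the least fixed point of the pointwise join f ⊔ g above x; that is, sInf {y | (f ∘ g) y = y ∧ x ≤ y} = sInf {y | f y ⊔ g y = y ∧ x ≤ y}. -/

import Mathlib

/-- For inflationary monotone `f g` on a complete lattice, the least fixed
point of `f ∘ g` above `x` equals the least fixed point of the pointwise join
`f ⊔ g` above `x`. -/
theorem stmt6 (L : Type*) [CompleteLattice L] (f g : L → L)
    (hfinfl : ∀ x : L, x ≤ f x) (hfmono : Monotone f)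
    (hginfl : ∀ x : L, x ≤ g x) (hgmono : Monotone g) (x : L) :
    sInf {y : L | (f ∘ g) y = y ∧ x ≤ y} =
      sInf {y : L | f y ⊔ g y = y ∧ x ≤ y} := by
  congr 1
  ext y
  refine and_congr_left fun _ => ⟨fun h => ?_, fun h => ?_⟩
  · have hg : g y = y := le_antisymm ((hfinfl (g y)).trans h.le) (hginfl y)
    have hf : f y = y := by simpa [hg] using h
    rw [hf, hg, sup_idem]
  · have hf : f y = y := le_antisymm (le_sup_left.trans h.le) (hfinfl y)
    have hg : g y = y := le_antisymm (le_sup_right.trans h.le) (hginfl y)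
    rw [Function.comp_apply, hg, hf]
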